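/- Let C̲ be a cocleft G-coalgebra with C_e cocommutative, with convolution invertible u̲ : C̲ → k⟨G⟩ (maps u_α ∈ C_α*, v_α ∈ C_{α⁻¹}*), and define λ_α : C_e → C_e by λ_α(c) = u_α(c_{(1,α)}) c_{(2,e)} v_α(c_{(3,α⁻¹)}). Then: (1) the maps λ_α are independent of the choice of the convolution invertible morphism u̲; (2) writing c·α = λ_α(c), for all α ∈ G and c ∈ C_α one has c_{(1,α)} ⊗ c_{(2,e)} = c_{(2,α)} ⊗ (c_{(1,e)}·α) in C_α ⊗ C_e. -/

import Mathlib

open TensorProduct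

universe u

/-- A `G`-group coalgebra over `k`: a family of `k`-vector spaces `C α` with
comultiplications `Δ_{α,β} : C (α*β) → C α ⊗ C β` and a counit `ε : C 1 → k`.
The comultiplication takes an explicit proof `γ = α * β` to avoid dependent casts. -/
structure GCoalgebra (k : Type u) [Field k] (G : Type u) [Group G] where
  C : G → Type u
  [acg : ∀ α, AddCommGroup (C α)]
  [mod : ∀ α, Module k (C α)]
  Δ : ∀ ⦃γ⦄ (α β : G), γ = α * β → (C γ →ₗ[k] C α ⊗[k] C β)
  ε : C 1 →ₗ[k] k
  coassoc : ∀ ⦃δ δ₁ δ₂ : G⦄ (α β γ : G) (h₁ : δ = δ₁ * γ) (h₁' : δ₁ = α * β)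
      (h₂ : δ = α * δ₂) (h₂' : δ₂ = β * γ),
      (TensorProduct.assoc k (C α) (C β) (C γ)).toLinearMap ∘ₗ
        (TensorProduct.map (Δ α β h₁') LinearMap.id) ∘ₗ Δ δ₁ γ h₁
      = (TensorProduct.map LinearMap.id (Δ β γ h₂')) ∘ₗ Δ α δ₂ h₂
  counit_right : ∀ (α : G) (h : α = α * 1),
      (TensorProduct.rid k (C α)).toLinearMap ∘ₗ
        (TensorProduct.map LinearMap.id ε) ∘ₗ Δ α 1 h = LinearMap.id
  counit_left : ∀ (α : G) (h : α = 1 * α),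
      (TensorProduct.lid k (C α)).toLinearMap ∘ₗ
        (TensorProduct.map ε LinearMap.id) ∘ₗ Δ 1 α h = LinearMap.id

attribute [instance] GCoalgebra.acg GCoalgebra.mod

variable {k : Type u} [Field k] {G : Type u} [Group G]

/-- A right `G`-`C̲`-comodule. -/
structure GComodule (Cc : GCoalgebra k G) where
  M : G → Type u
  [acg : ∀ α, AddCommGroup (M α)]
  [mod : ∀ α, Module k (M α)]
  ρ : ∀ ⦃γ⦄ (α β : G), γ = α * β → (M γ →ₗ[k] M α ⊗[k] Cc.C β)
  counit : ∀ (α : G) (h : α = α * 1),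
      (TensorProduct.rid k (M α)).toLinearMap ∘ₗ
        (TensorProduct.map LinearMap.id Cc.ε) ∘ₗ ρ α 1 h = LinearMap.id
  coassoc : ∀ ⦃δ δ₁ δ₂ : G⦄ (α β γ : G) (h₁ : δ = δ₁ * γ) (h₁' : δ₁ = α * β)
      (h₂ : δ = α * δ₂) (h₂' : δ₂ = β * γ),
      (TensorProduct.assoc k (M α) (Cc.C β) (Cc.C γ)).toLinearMap ∘ₗ
        (TensorProduct.map (ρ α β h₁') LinearMap.id) ∘ₗ ρ δ₁ γ h₁
      = (TensorProduct.map LinearMap.id (Cc.Δ β γ h₂')) ∘ₗ ρ α δ₂ h₂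

attribute [instance] GComodule.acg GComodule.mod

/-- A morphism of right `G`-`C̲`-comodules. -/
structure GComodHom {Cc : GCoalgebra k G} (M N : GComodule Cc) where
  φ : ∀ α, M.M α →ₗ[k] N.M α
  colinear : ∀ ⦃γ⦄ (α β : G) (h : γ = α * β),
      (TensorProduct.map (φ α) LinearMap.id) ∘ₗ M.ρ α β h = N.ρ α β h ∘ₗ φ γ

/-- A `G`-coalgebra is strong if all comultiplication maps are injective. -/
def GCoalgebra.Strong (Cc : GCoalgebra k G) : Prop :=
  ∀ (α β : G), Function.Injective (Cc.Δ α β rfl)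
/-- The map `λ_α : C_e → C_e`, `λ_α(c) = u_α(c_{(1,α)}) c_{(2,e)} v_α(c_{(3,α⁻¹)})`,
attached to a convolution invertible `u̲ : C̲ → k⟨G⟩`. -/
noncomputable def cleftLam {k G : Type u} [Field k] [Group G] (Cc : GCoalgebra k G)
    (u : ∀ α : G, Cc.C α →ₗ[k] k) (v : ∀ α : G, Cc.C α⁻¹ →ₗ[k] k) (α : G) :
    Cc.C 1 →ₗ[k] Cc.C 1 :=
  (TensorProduct.lid k (Cc.C 1)).toLinearMap ∘ₗ
    TensorProduct.map (u α)
      ((TensorProduct.rid k (Cc.C 1)).toLinearMap ∘ₗ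
        TensorProduct.map LinearMap.id (v α)) ∘ₗ
    LinearMap.lTensor (Cc.C α) (Cc.Δ 1 α⁻¹ (one_mul α⁻¹).symm) ∘ₗ
    Cc.Δ α α⁻¹ (mul_inv_cancel α).symm

/-- `(u, v)` is a convolution invertible morphism `u̲ : C̲ → k⟨G⟩` in `(M_k)^G`:
`u_α(c_{(1,α)}) v_α(c_{(2,α⁻¹)}) = v_α(c_{(1,α⁻¹)}) u_α(c_{(2,α)}) = ε(c)`. -/
def IsConvInvPair {k G : Type u} [Field k] [Group G] (Cc : GCoalgebra k G)
    (u : ∀ α : G, Cc.C α →ₗ[k] k) (v : ∀ α : G, Cc.C α⁻¹ →ₗ[k] k) : Prop :=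
  ∀ α : G,
    LinearMap.mul' k k ∘ₗ TensorProduct.map (u α) (v α) ∘ₗ
        Cc.Δ α α⁻¹ (mul_inv_cancel α).symm = Cc.ε ∧
    LinearMap.mul' k k ∘ₗ TensorProduct.map (v α) (u α) ∘ₗ
        Cc.Δ α⁻¹ α (inv_mul_cancel α).symm = Cc.ε

/-- `C_e` is cocommutative. -/
def CeCocommutative {k G : Type u} [Field k] [Group G] (Cc : GCoalgebra k G) : Prop :=
  (TensorProduct.comm k (Cc.C 1) (Cc.C 1)).toLinearMap ∘ₗ Cc.Δ 1 1 (one_mul 1).symm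
    = Cc.Δ 1 1 (one_mul 1).symm
namespace GCoalgebra

variable (Cc : GCoalgebra k G) {α β γ δ δ₁ δ₂ : G}

/-- Contraction of the left comultiplication factor: `c ↦ f(c_{(1,α)}) c_{(2,β)}`. -/
noncomputable def contractLeft (f : Cc.C α →ₗ[k] k) (h : γ = α * β) : Cc.C γ →ₗ[k] Cc.C β :=
  (TensorProduct.lid k (Cc.C β)).toLinearMap ∘ₗ
    TensorProduct.map f LinearMap.id ∘ₗ Cc.Δ α β h

/-- Contraction of the right comultiplication factor: `c ↦ c_{(1,α)} f(c_{(2,β)})`. -/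
noncomputable def contractRight (f : Cc.C β →ₗ[k] k) (h : γ = α * β) : Cc.C γ →ₗ[k] Cc.C α :=
  (TensorProduct.rid k (Cc.C α)).toLinearMap ∘ₗ
    TensorProduct.map LinearMap.id f ∘ₗ Cc.Δ α β h

/-- The convolution product `c ↦ f(c_{(1,α)}) g(c_{(2,β)})`. -/
noncomputable def convMul (f : Cc.C α →ₗ[k] k) (g : Cc.C β →ₗ[k] k) (h : γ = α * β) :
    Cc.C γ →ₗ[k] k :=
  LinearMap.mul' k k ∘ₗ TensorProduct.map f g ∘ₗ Cc.Δ α β h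

lemma contractLeft_counit (h : α = 1 * α) : Cc.contractLeft Cc.ε h = LinearMap.id :=
  Cc.counit_left α h

lemma contractRight_counit (h : α = α * 1) : Cc.contractRight Cc.ε h = LinearMap.id :=
  Cc.counit_right α h

lemma map_contractLeft_comp (f : Cc.C α →ₗ[k] k) (h₁ : δ = δ₁ * γ) (h₁' : δ₁ = α * β)
    (h₂ : δ = α * δ₂) (h₂' : δ₂ = β * γ) :
    TensorProduct.map (Cc.contractLeft f h₁') LinearMap.id ∘ₗ Cc.Δ δ₁ γ h₁ =
      Cc.Δ β γ h₂' ∘ₗ Cc.contractLeft f h₂ := by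
  let F := (TensorProduct.lid k (Cc.C β ⊗[k] Cc.C γ)).toLinearMap ∘ₗ
    TensorProduct.map f LinearMap.id
  have hl : TensorProduct.map (Cc.contractLeft f h₁') LinearMap.id =
      F ∘ₗ (TensorProduct.assoc k (Cc.C α) (Cc.C β) (Cc.C γ)).toLinearMap ∘ₗ
        TensorProduct.map (Cc.Δ α β h₁') (LinearMap.id : Cc.C γ →ₗ[k] Cc.C γ) := by
    have : F ∘ₗ (TensorProduct.assoc k (Cc.C α) (Cc.C β) (Cc.C γ)).toLinearMap =
        TensorProduct.map ((TensorProduct.lid k (Cc.C β)).toLinearMap ∘ₗ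
          TensorProduct.map f LinearMap.id) LinearMap.id := by
      ext a b c
      simp [F, TensorProduct.smul_tmul']
    rw [← LinearMap.comp_assoc, this, ← TensorProduct.map_comp]
    rfl
  have hr : Cc.Δ β γ h₂' ∘ₗ (TensorProduct.lid k (Cc.C δ₂)).toLinearMap ∘ₗ
      TensorProduct.map f LinearMap.id = F ∘ₗ TensorProduct.map LinearMap.id (Cc.Δ β γ h₂') := by
    ext a b
    simp [F]
  rw [hl, contractLeft, ← LinearMap.comp_assoc (Cc.Δ α δ₂ h₂),
    ← LinearMap.comp_assoc (Cc.Δ α δ₂ h₂), hr]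
  simp only [LinearMap.comp_assoc]
  rw [Cc.coassoc α β γ h₁ h₁' h₂ h₂']

lemma map_contractRight_comp (f : Cc.C β →ₗ[k] k) (h₁ : δ = δ₁ * γ) (h₁' : δ₁ = α * β)
    (h₂ : δ = α * δ₂) (h₂' : δ₂ = β * γ) :
    TensorProduct.map (Cc.contractRight f h₁') LinearMap.id ∘ₗ Cc.Δ δ₁ γ h₁ =
      TensorProduct.map LinearMap.id (Cc.contractLeft f h₂') ∘ₗ Cc.Δ α δ₂ h₂ := by
  let F := TensorProduct.map (LinearMap.id : Cc.C α →ₗ[k] Cc.C α)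
    ((TensorProduct.lid k (Cc.C γ)).toLinearMap ∘ₗ TensorProduct.map f LinearMap.id)
  have hl : TensorProduct.map (Cc.contractRight f h₁') LinearMap.id =
      F ∘ₗ (TensorProduct.assoc k (Cc.C α) (Cc.C β) (Cc.C γ)).toLinearMap ∘ₗ
        TensorProduct.map (Cc.Δ α β h₁') (LinearMap.id : Cc.C γ →ₗ[k] Cc.C γ) := by
    have : F ∘ₗ (TensorProduct.assoc k (Cc.C α) (Cc.C β) (Cc.C γ)).toLinearMap =
        TensorProduct.map ((TensorProduct.rid k (Cc.C α)).toLinearMap ∘ₗ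
          TensorProduct.map LinearMap.id f) LinearMap.id := by
      ext a b c
      simp [F, TensorProduct.smul_tmul]
    rw [← LinearMap.comp_assoc, this, ← TensorProduct.map_comp]
    rfl
  have hr : TensorProduct.map LinearMap.id (Cc.contractLeft f h₂') =
      F ∘ₗ TensorProduct.map LinearMap.id (Cc.Δ β γ h₂') := by
    rw [← TensorProduct.map_comp]
    rfl
  rw [hl, hr]
  simp only [LinearMap.comp_assoc]
  rw [Cc.coassoc α β γ h₁ h₁' h₂ h₂']

lemma contractLeft_comp_contractLeft (f : Cc.C α →ₗ[k] k) (g : Cc.C β →ₗ[k] k)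
    (h₁ : δ = δ₁ * γ) (h₁' : δ₁ = α * β) (h₂ : δ = α * δ₂) (h₂' : δ₂ = β * γ) :
    Cc.contractLeft g h₂' ∘ₗ Cc.contractLeft f h₂ =
      Cc.contractLeft (Cc.convMul f g h₁') h₁ := by
  have hfg : g ∘ₗ Cc.contractLeft f h₁' = Cc.convMul f g h₁' := by
    have : g ∘ₗ (TensorProduct.lid k (Cc.C β)).toLinearMap ∘ₗ
        TensorProduct.map f LinearMap.id = LinearMap.mul' k k ∘ₗ TensorProduct.map f g := by
      ext a b
      simp
    exact congrArg (· ∘ₗ Cc.Δ α β h₁') this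
  rw [← hfg]
  conv_lhs => rw [contractLeft]
  conv_rhs => rw [contractLeft]
  simp only [LinearMap.comp_assoc]
  rw [← Cc.map_contractLeft_comp f h₁ h₁' h₂ h₂', ← LinearMap.comp_assoc (Cc.Δ δ₁ γ h₁),
    ← TensorProduct.map_comp, LinearMap.comp_id]

lemma contractRight_comp_contractRight (f : Cc.C β →ₗ[k] k) (g : Cc.C γ →ₗ[k] k)
    (h₁ : δ = δ₁ * γ) (h₁' : δ₁ = α * β) (h₂ : δ = α * δ₂) (h₂' : δ₂ = β * γ) :
    Cc.contractRight f h₁' ∘ₗ Cc.contractRight g h₁ =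
      Cc.contractRight (Cc.convMul f g h₂') h₂ := by
  have hfg : g ∘ₗ Cc.contractLeft f h₂' = Cc.convMul f g h₂' := by
    have : g ∘ₗ (TensorProduct.lid k (Cc.C γ)).toLinearMap ∘ₗ
        TensorProduct.map f LinearMap.id = LinearMap.mul' k k ∘ₗ TensorProduct.map f g := by
      ext a b
      simp
    exact congrArg (· ∘ₗ Cc.Δ β γ h₂') this
  have hR : Cc.contractRight f h₁' ∘ₗ (TensorProduct.rid k (Cc.C δ₁)).toLinearMap ∘ₗ
      TensorProduct.map LinearMap.id g = (TensorProduct.rid k (Cc.C α)).toLinearMap ∘ₗ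
      TensorProduct.map LinearMap.id g ∘ₗ
      TensorProduct.map (Cc.contractRight f h₁') LinearMap.id := by
    ext a b
    simp
  rw [← hfg, contractRight.eq_def Cc g, ← LinearMap.comp_assoc (Cc.Δ δ₁ γ h₁),
    ← LinearMap.comp_assoc (Cc.Δ δ₁ γ h₁), hR]
  simp only [LinearMap.comp_assoc]
  rw [Cc.map_contractRight_comp f h₁ h₁' h₂ h₂', contractRight,
    ← LinearMap.comp_assoc (Cc.Δ α δ₂ h₂) (TensorProduct.map _ _), ← TensorProduct.map_comp,
    LinearMap.comp_id]

end GCoalgebra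

lemma cleftLam_eq_contractRight_comp_contractLeft (Cc : GCoalgebra k G)
    (u : ∀ α : G, Cc.C α →ₗ[k] k) (v : ∀ α : G, Cc.C α⁻¹ →ₗ[k] k) (α : G) :
    cleftLam Cc u v α = Cc.contractRight (v α) (one_mul α⁻¹).symm ∘ₗ
      Cc.contractLeft (u α) (mul_inv_cancel α).symm := by
  rw [cleftLam, GCoalgebra.contractLeft]
  simp only [← LinearMap.comp_assoc]
  congr 1
  ext a b
  simp [GCoalgebra.contractRight]

/-- For every `c ∈ C_α`, `c_{(1,α)} ⊗ c_{(2,e)} = c_{(2,α)} ⊗ λ_α(c_{(1,e)})`. -/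
lemma comul_right_one_eq_cleftLam (Cc : GCoalgebra k G) (hcocomm : CeCocommutative Cc)
    {u : ∀ α : G, Cc.C α →ₗ[k] k} {v : ∀ α : G, Cc.C α⁻¹ →ₗ[k] k}
    (huv : IsConvInvPair Cc u v) (α : G) :
    Cc.Δ α 1 (mul_one α).symm = (TensorProduct.comm k (Cc.C 1) (Cc.C α)).toLinearMap ∘ₗ
      TensorProduct.map (cleftLam Cc u v α) LinearMap.id ∘ₗ Cc.Δ 1 α (one_mul α).symm := by
  let L := Cc.contractLeft (v α) (inv_mul_cancel α).symm
  let M := Cc.contractLeft (u α) (mul_one α).symm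
  have hcomm : (TensorProduct.comm k (Cc.C 1) (Cc.C α)).toLinearMap ∘ₗ
      TensorProduct.map LinearMap.id L =
      TensorProduct.map L LinearMap.id ∘ₗ
        (TensorProduct.comm k (Cc.C 1) (Cc.C 1)).toLinearMap := by
    ext a b
    simp
  have hLM : L ∘ₗ M = LinearMap.id := by
    rw [Cc.contractLeft_comp_contractLeft (u α) (v α) (one_mul α).symm
      (mul_inv_cancel α).symm (mul_one α).symm (inv_mul_cancel α).symm,
      GCoalgebra.convMul, (huv α).1, Cc.contractLeft_counit]
  symm
  calc
    _ = (TensorProduct.comm k (Cc.C 1) (Cc.C α)).toLinearMap ∘ₗ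
        TensorProduct.map (Cc.contractRight (v α) (one_mul α⁻¹).symm) LinearMap.id ∘ₗ
        TensorProduct.map (Cc.contractLeft (u α) (mul_inv_cancel α).symm) LinearMap.id ∘ₗ
        Cc.Δ 1 α (one_mul α).symm := by
      rw [cleftLam_eq_contractRight_comp_contractLeft,
        ← LinearMap.comp_assoc (Cc.Δ 1 α (one_mul α).symm) (TensorProduct.map _ _)
          (TensorProduct.map _ _), ← TensorProduct.map_comp, LinearMap.comp_id]
    _ = (TensorProduct.comm k (Cc.C 1) (Cc.C α)).toLinearMap ∘ₗ
        (TensorProduct.map LinearMap.id L ∘ₗ Cc.Δ 1 1 (one_mul 1).symm) ∘ₗ M := by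
      rw [Cc.map_contractLeft_comp (u α) (one_mul α).symm (mul_inv_cancel α).symm
        (mul_one α).symm (inv_mul_cancel α).symm,
        ← Cc.map_contractRight_comp (v α) (inv_mul_cancel α).symm (one_mul α⁻¹).symm
        (one_mul 1).symm (inv_mul_cancel α).symm, LinearMap.comp_assoc]
    _ = TensorProduct.map L LinearMap.id ∘ₗ
        ((TensorProduct.comm k (Cc.C 1) (Cc.C 1)).toLinearMap ∘ₗ
          Cc.Δ 1 1 (one_mul 1).symm) ∘ₗ M := by
      simp only [← LinearMap.comp_assoc]
      rw [hcomm]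
    _ = Cc.Δ α 1 (mul_one α).symm ∘ₗ L ∘ₗ M := by
      rw [hcocomm, ← LinearMap.comp_assoc, Cc.map_contractLeft_comp (v α) (one_mul 1).symm
        (inv_mul_cancel α).symm (inv_mul_cancel α).symm (mul_one α).symm, LinearMap.comp_assoc]
    _ = Cc.Δ α 1 (mul_one α).symm := by rw [hLM, LinearMap.comp_id]

/-- A linear endomorphism `f` of `C_e` is determined by `c ↦ f(c_{(1,e)}) ⊗ c_{(2,α)}`
when `C̲` is cocleft. -/
lemma IsConvInvPair.eq_of_map_comp_comul_eq {Cc : GCoalgebra k G}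
    {u : ∀ α : G, Cc.C α →ₗ[k] k} {v : ∀ α : G, Cc.C α⁻¹ →ₗ[k] k}
    (huv : IsConvInvPair Cc u v) (α : G) {f g : Cc.C 1 →ₗ[k] Cc.C 1}
    (hfg : TensorProduct.map f LinearMap.id ∘ₗ Cc.Δ 1 α (one_mul α).symm =
      TensorProduct.map g LinearMap.id ∘ₗ Cc.Δ 1 α (one_mul α).symm) : f = g := by
  let R := Cc.contractRight (u α) (one_mul α).symm
  let S := Cc.contractRight (v α) (mul_inv_cancel α).symm
  have hRS : R ∘ₗ S = LinearMap.id := by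
    rw [Cc.contractRight_comp_contractRight (u α) (v α) (mul_inv_cancel α).symm
      (one_mul α).symm (one_mul 1).symm (mul_inv_cancel α).symm,
      GCoalgebra.convMul, (huv α).1, Cc.contractRight_counit]
  have key (p : Cc.C 1 →ₗ[k] Cc.C 1) : p ∘ₗ R =
      ((TensorProduct.rid k (Cc.C 1)).toLinearMap ∘ₗ TensorProduct.map LinearMap.id (u α)) ∘ₗ
      TensorProduct.map p LinearMap.id ∘ₗ Cc.Δ 1 α (one_mul α).symm := by
    simp only [R, GCoalgebra.contractRight, ← LinearMap.comp_assoc]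
    congr 1
    ext a b
    simp
  rw [← LinearMap.comp_id f, ← LinearMap.comp_id g, ← hRS, ← LinearMap.comp_assoc,
    ← LinearMap.comp_assoc, key f, key g, hfg]

/-- **Lemma 4.3.** Let `C̲` be a cocleft `G`-coalgebra with `C_e` cocommutative, with
convolution invertible `u̲ : C̲ → k⟨G⟩`, and `λ_α(c) = u_α(c_{(1,α)}) c_{(2,e)} v_α(c_{(3,α⁻¹)})`.
Then: (1) the `λ_α` do not depend on the choice of `u̲`; (2) for all `α` and `c ∈ C_α`,
`c_{(1,α)} ⊗ c_{(2,e)} = c_{(2,α)} ⊗ (c_{(1,e)}·α)` in `C_α ⊗ C_e`. -/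
theorem cleftLam_independent_and_symmetry {k G : Type u} [Field k] [Group G]
    (Cc : GCoalgebra k G) (hcocomm : CeCocommutative Cc)
    (u : ∀ α : G, Cc.C α →ₗ[k] k) (v : ∀ α : G, Cc.C α⁻¹ →ₗ[k] k)
    (huv : IsConvInvPair Cc u v)
    (u' : ∀ α : G, Cc.C α →ₗ[k] k) (v' : ∀ α : G, Cc.C α⁻¹ →ₗ[k] k)
    (huv' : IsConvInvPair Cc u' v') :
    (∀ α : G, cleftLam Cc u v α = cleftLam Cc u' v' α) ∧
    (∀ α : G,
      Cc.Δ α 1 (mul_one α).symm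
        = (TensorProduct.comm k (Cc.C 1) (Cc.C α)).toLinearMap ∘ₗ
            TensorProduct.map (cleftLam Cc u v α) LinearMap.id ∘ₗ
            Cc.Δ 1 α (one_mul α).symm) := by
  refine ⟨fun α => huv.eq_of_map_comp_comul_eq α ?_, comul_right_one_eq_cleftLam Cc hcocomm huv⟩
  exact (LinearMap.cancel_left (TensorProduct.comm k (Cc.C 1) (Cc.C α)).injective).1 <|
    (comul_right_one_eq_cleftLam Cc hcocomm huv α).symm.trans
      (comul_right_one_eq_cleftLam Cc hcocomm huv' α)
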